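/- arXiv:2412.01756 — 3 statements merged into one kernel-verified Lean document; each statement's English description precedes it below -/
import Mathlib

section
/- Let Φ denote the standard normal CDF, let μ > 0, ε ≥ 0, and set δ(ε, μ) = Φ(−ε/μ + μ/2) − e^ε Φ(−ε/μ − μ/2). Let P = N(m + μ, 1) and Q = N(m, 1) be Gaussian probability measures on ℝ (for any m ∈ ℝ). Then for every measurable set S ⊆ ℝ, P(S) ≤ e^ε · Q(S) + δ(ε, μ). That is, the one-dimensional Gaussian mechanism with unit noise and sensitivity μ satisfies the (ε, δ(ε))-DP inequality with δ(ε) as in the μ-GDP conversion formula. -/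
open MeasureTheory ProbabilityTheory

/-- The standard normal CDF `Φ`. -/
noncomputable def stdNormalCDF (x : ℝ) : ℝ :=
  ((gaussianReal 0 1) (Set.Iic x)).toReal

/-- The upper tail of a unit-variance Gaussian in terms of `Φ`. -/
theorem gaussianReal_Ici_toReal (a t : ℝ) :
    ((gaussianReal a 1) (Set.Ici t)).toReal = stdNormalCDF (a - t) := by
  have hmap : (gaussianReal a 1).map (fun x ↦ a - x) = gaussianReal 0 1 := by
    rw [gaussianReal_map_const_sub, sub_self]
  rw [stdNormalCDF, ← hmap, Measure.map_apply (by fun_prop) measurableSet_Iic]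
  congr 2
  ext x
  simp

/-- The probability of a set under a unit-variance Gaussian is the integral of the density. -/
theorem gaussianReal_toReal_eq_setIntegral (a : ℝ) (S : Set ℝ) :
    ((gaussianReal a 1) S).toReal = ∫ x in S, gaussianPDFReal a 1 x := by
  rw [gaussianReal_apply_eq_integral a one_ne_zero, ENNReal.toReal_ofReal]
  exact integral_nonneg fun x ↦ gaussianPDFReal_nonneg a 1 x

/-- The region where the likelihood ratio of two shifted unit-variance Gaussians is at least
`e^ε` is a half-line. -/
theorem gaussianPDFReal_exp_mul_le_iff {μ : ℝ} (hμ : 0 < μ) (ε m x : ℝ) :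
    Real.exp ε * gaussianPDFReal m 1 x ≤ gaussianPDFReal (m + μ) 1 x ↔
      m + ε / μ + μ / 2 ≤ x := by
  have hc : 0 < (√(2 * Real.pi * (1 : NNReal)))⁻¹ := by
    have := Real.pi_pos
    simp only [NNReal.coe_one]
    positivity
  rw [gaussianPDFReal, gaussianPDFReal, mul_left_comm, mul_le_mul_iff_right₀ hc, ← Real.exp_add,
    Real.exp_le_exp, NNReal.coe_one, ← mul_le_mul_iff_right₀ hμ (b := m + ε / μ + μ / 2)]
  have h : μ * (m + ε / μ + μ / 2) = μ * m + ε + μ ^ 2 / 2 := by field_simp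
  rw [h]
  constructor <;> intro h' <;> nlinarith

/-- The unit-variance Gaussian mechanism with sensitivity `μ` satisfies the
`(ε, δ(ε,μ))`-DP inequality with `δ(ε,μ) = Φ(-ε/μ + μ/2) - e^ε Φ(-ε/μ - μ/2)`. -/
theorem gaussian_mechanism_dp_inequality
    (μ : ℝ) (hμ : 0 < μ) (ε : ℝ) (hε : 0 ≤ ε) (m : ℝ)
    (S : Set ℝ) (hS : MeasurableSet S) :
    ((gaussianReal (m + μ) 1) S).toReal ≤
      Real.exp ε * ((gaussianReal m 1) S).toReal +
        (stdNormalCDF (-ε / μ + μ / 2) - Real.exp ε * stdNormalCDF (-ε / μ - μ / 2)) := by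
  have hpdf (a : ℝ) : Integrable (gaussianPDFReal a 1) := integrable_gaussianPDFReal a 1
  have hexcess (T : Set ℝ) :
      ∫ x in T, (gaussianPDFReal (m + μ) 1 x - Real.exp ε * gaussianPDFReal m 1 x) =
        ((gaussianReal (m + μ) 1) T).toReal - Real.exp ε * ((gaussianReal m 1) T).toReal := by
    rw [integral_sub (hpdf _).integrableOn ((hpdf _).const_mul _).integrableOn,
      integral_const_mul, gaussianReal_toReal_eq_setIntegral, gaussianReal_toReal_eq_setIntegral]
  have hregion : {x | 0 ≤ gaussianPDFReal (m + μ) 1 x - Real.exp ε * gaussianPDFReal m 1 x} =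
      Set.Ici (m + ε / μ + μ / 2) := by
    ext x
    simp only [Set.mem_ofPred_eq, sub_nonneg, Set.mem_Ici, gaussianPDFReal_exp_mul_le_iff hμ]
  have hle := setIntegral_le_nonneg hS
    (((measurable_gaussianPDFReal (m + μ) 1).sub
      ((measurable_gaussianPDFReal m 1).const_mul (Real.exp ε))).stronglyMeasurable)
    ((hpdf (m + μ)).sub ((hpdf m).const_mul (Real.exp ε)))
  simp only [Pi.sub_apply] at hle
  rw [hregion, hexcess, hexcess, gaussianReal_Ici_toReal, gaussianReal_Ici_toReal] at hle
  have hP : m + μ - (m + ε / μ + μ / 2) = -ε / μ + μ / 2 := by ring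
  have hQ : m - (m + ε / μ + μ / 2) = -ε / μ - μ / 2 := by ring
  rw [hP, hQ] at hle
  linarith
end

section
/- Let Φ denote the standard normal CDF and fix μ > 0. Define δ(ε) = Φ(−ε/μ + μ/2) − e^ε Φ(−ε/μ − μ/2) for ε ≥ 0. Then δ is differentiable on (0, ∞) with dδ/dε = −e^ε Φ(−ε/μ − μ/2) < 0; in particular δ is strictly decreasing in ε. -/
open MeasureTheory ProbabilityTheory

/-- The standard normal CDF has the standard normal density as its derivative. -/
theorem hasDerivAt_stdNormalCDF (x : ℝ) :
    HasDerivAt stdNormalCDF (gaussianPDFReal 0 1 x) x := by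
  have hcont : Continuous (gaussianPDFReal 0 1) := by
    unfold gaussianPDFReal
    fun_prop
  have hint := integrable_gaussianPDFReal 0 1
  have hΦ : stdNormalCDF = fun y ↦
      (∫ t in Set.Iic 0, gaussianPDFReal 0 1 t) + ∫ t in (0 : ℝ)..y, gaussianPDFReal 0 1 t := by
    funext y
    rw [← intervalIntegral.integral_Iic_sub_Iic hint.integrableOn hint.integrableOn,
      stdNormalCDF, gaussianReal_apply_eq_integral _ one_ne_zero,
      ENNReal.toReal_ofReal (integral_nonneg fun t ↦ gaussianPDFReal_nonneg 0 1 t)]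
    ring
  rw [hΦ]
  exact (intervalIntegral.integral_hasDerivAt_right (hcont.intervalIntegrable 0 x)
    (hcont.stronglyMeasurableAtFilter _ _) hcont.continuousAt).const_add _

/-- The standard normal CDF is strictly positive everywhere. -/
theorem stdNormalCDF_pos (x : ℝ) : 0 < stdNormalCDF x := by
  refine ENNReal.toReal_pos (fun h ↦ ?_) (measure_ne_top _ _)
  have hvol := gaussianReal_absolutelyContinuous' 0 one_ne_zero h
  simp at hvol

/-- The density identity `φ(-ε/μ + μ/2) = e^ε φ(-ε/μ - μ/2)`. -/
theorem gaussianPDFReal_neg_div_add_half {μ : ℝ} (hμ : μ ≠ 0) (ε : ℝ) :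
    gaussianPDFReal 0 1 (-ε / μ + μ / 2) =
      Real.exp ε * gaussianPDFReal 0 1 (-ε / μ - μ / 2) := by
  simp only [gaussianPDFReal]
  rw [mul_left_comm, ← Real.exp_add]
  congr 2
  push_cast
  field_simp
  ring

/-- The derivative of the privacy curve of a `μ`-GDP mechanism. -/
theorem hasDerivAt_privacy_curve {μ : ℝ} (hμ : μ ≠ 0) (ε : ℝ) :
    HasDerivAt
      (fun ε : ℝ => stdNormalCDF (-ε / μ + μ / 2) -
        Real.exp ε * stdNormalCDF (-ε / μ - μ / 2))
      (-(Real.exp ε * stdNormalCDF (-ε / μ - μ / 2))) ε := by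
  have hlin : HasDerivAt (fun ε : ℝ ↦ -ε / μ) (-1 / μ) ε := (hasDerivAt_id ε).neg.div_const μ
  have hadd := (hasDerivAt_stdNormalCDF _).comp ε (hlin.add_const (μ / 2))
  have hsub := (hasDerivAt_stdNormalCDF _).comp ε (hlin.sub_const (μ / 2))
  refine (hadd.sub ((Real.hasDerivAt_exp ε).mul hsub)).congr_deriv ?_
  rw [gaussianPDFReal_neg_div_add_half hμ, Function.comp_apply]
  ring

/-- For fixed `μ > 0`, the privacy curve
`δ(ε) = Φ(-ε/μ + μ/2) - e^ε Φ(-ε/μ - μ/2)` is differentiable on `(0, ∞)` with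
strictly negative derivative `-e^ε Φ(-ε/μ - μ/2)`; in particular it is
strictly decreasing in `ε`. -/
theorem privacy_curve_strictAnti_in_eps (μ : ℝ) (hμ : 0 < μ) :
    (∀ ε ∈ Set.Ioi (0 : ℝ),
      HasDerivAt
        (fun ε : ℝ => stdNormalCDF (-ε / μ + μ / 2) -
          Real.exp ε * stdNormalCDF (-ε / μ - μ / 2))
        (-(Real.exp ε * stdNormalCDF (-ε / μ - μ / 2))) ε ∧
      -(Real.exp ε * stdNormalCDF (-ε / μ - μ / 2)) < 0) ∧
    StrictAntiOn
      (fun ε : ℝ => stdNormalCDF (-ε / μ + μ / 2) -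
        Real.exp ε * stdNormalCDF (-ε / μ - μ / 2))
      (Set.Ici 0) := by
  have hneg (ε : ℝ) : -(Real.exp ε * stdNormalCDF (-ε / μ - μ / 2)) < 0 :=
    neg_neg_of_pos (mul_pos (Real.exp_pos ε) (stdNormalCDF_pos _))
  have hderiv := hasDerivAt_privacy_curve hμ.ne'
  exact ⟨fun ε _ ↦ ⟨hderiv ε, hneg ε⟩,
    (strictAnti_of_hasDerivAt_neg hderiv hneg).strictAntiOn _⟩
end

section
/- Let Φ denote the standard normal CDF, let Δ ≥ 0 be a sensitivity bound and σ > 0 a noise scale, and suppose Δ > 0. Let f_D, f_{D'} ∈ ℝ satisfy |f_D − f_{D'}| ≤ Δ, and let P = N(f_{D'}, σ²), Q = N(f_D, σ²). Then for every ε ≥ 0 and every measurable set S ⊆ ℝ, P(S) ≤ e^ε Q(S) + δ(ε, Δ/σ), where δ(ε, μ) = Φ(−ε/μ + μ/2) − e^ε Φ(−ε/μ − μ/2). -/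
open MeasureTheory ProbabilityTheory

/-- The `(ε, δ)`-DP conversion curve of μ-GDP:
`δ(ε, μ) = Φ(-ε/μ + μ/2) - e^ε Φ(-ε/μ - μ/2)`. -/
noncomputable def gdpDelta (ε μ : ℝ) : ℝ :=
  stdNormalCDF (-ε / μ + μ / 2) - Real.exp ε * stdNormalCDF (-ε / μ - μ / 2)

lemma gaussianReal_real_Ici (m t : ℝ) :
    (gaussianReal m 1).real (Set.Ici t) = stdNormalCDF (m - t) := by
  have h := gaussianReal_map_const_sub (μ := m) (v := 1) m
  rw [sub_self] at h
  rw [stdNormalCDF, ← h, Measure.map_apply (by fun_prop) measurableSet_Iic, Measure.real]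
  congr 2
  ext x
  simp

lemma exp_mul_gaussianPDFReal_le_iff {μ : ℝ} (hμ : 0 < μ) (ε x : ℝ) :
    Real.exp ε * gaussianPDFReal 0 1 x ≤ gaussianPDFReal μ 1 x ↔ ε / μ + μ / 2 ≤ x := by
  have hc : 0 < (√(2 * Real.pi * (1 : NNReal)))⁻¹ := by simp; positivity
  rw [gaussianPDFReal, gaussianPDFReal, mul_left_comm, mul_le_mul_iff_right₀ hc, ← Real.exp_add,
    Real.exp_le_exp, ← mul_le_mul_iff_right₀ hμ (b := ε / μ + μ / 2),
    show μ * (ε / μ + μ / 2) = ε + μ ^ 2 / 2 by field_simp]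
  simp only [NNReal.coe_one]
  constructor <;> intro h <;> nlinarith

lemma integrable_gaussianPDFReal_mul {g : ℝ → ℝ} (hg : Measurable g) (h0 : ∀ x, 0 ≤ g x)
    (h1 : ∀ x, g x ≤ 1) (m : ℝ) (v : NNReal) :
    Integrable fun x ↦ gaussianPDFReal m v x * g x :=
  (integrable_gaussianPDFReal m v).mul_bdd (c := 1) hg.aestronglyMeasurable
    (.of_forall fun x ↦ by rw [Real.norm_of_nonneg (h0 x)]; exact h1 x)

/-- The hockey-stick bound for randomized tests between two unit-variance Gaussians. -/
lemma integral_gaussianReal_le_add_gdpDelta {μ : ℝ} (hμ : 0 < μ) (ε : ℝ) {g : ℝ → ℝ}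
    (hg : Measurable g) (h0 : ∀ x, 0 ≤ g x) (h1 : ∀ x, g x ≤ 1) :
    ∫ x, g x ∂gaussianReal μ 1 ≤
      Real.exp ε * ∫ x, g x ∂gaussianReal 0 1 + gdpDelta ε μ := by
  set A := Set.Ici (ε / μ + μ / 2) with hA
  have hδ : gdpDelta ε μ =
      (gaussianReal μ 1).real A - Real.exp ε * (gaussianReal 0 1).real A := by
    rw [gaussianReal_real_Ici, gaussianReal_real_Ici, gdpDelta]
    congr 2 <;> [skip; congr 1] <;> ring
  have key : ∀ m : ℝ, (gaussianReal m 1).real A =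
      ∫ x, A.indicator 1 x ∂gaussianReal m 1 := fun m ↦
    (integral_indicator_one measurableSet_Ici).symm
  have hi0 : ∀ x, 0 ≤ A.indicator (1 : ℝ → ℝ) x :=
    Set.indicator_nonneg fun _ _ ↦ zero_le_one
  have hi1 : ∀ x, A.indicator (1 : ℝ → ℝ) x ≤ 1 :=
    Set.indicator_le_self' fun _ _ ↦ zero_le_one
  have hi : Measurable (A.indicator (1 : ℝ → ℝ)) := measurable_one.indicator measurableSet_Ici
  rw [hδ, key, key]
  simp only [integral_gaussianReal_eq_integral_smul one_ne_zero, smul_eq_mul]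
  have I := fun m ↦ integrable_gaussianPDFReal_mul hg h0 h1 m 1
  have J := fun m ↦ integrable_gaussianPDFReal_mul hi hi0 hi1 m 1
  have hle := integral_mono ((I μ).add ((J 0).const_mul (Real.exp ε)))
    (((I 0).const_mul (Real.exp ε)).add (J μ)) fun x ↦ by
      have hiff := exp_mul_gaussianPDFReal_le_iff hμ ε x
      simp only [Pi.add_apply]
      by_cases hx : x ∈ A
      · have := hiff.2 hx
        simp only [Set.indicator_of_mem hx, Pi.one_apply]
        nlinarith [h1 x]
      · have := not_le.1 fun h ↦ hx (hiff.1 h)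
        simp only [Set.indicator_of_notMem hx]
        nlinarith [h0 x]
  simp only [Pi.add_apply] at hle
  rw [integral_add (I μ) ((J 0).const_mul _), integral_add ((I 0).const_mul _) (J μ),
    integral_const_mul, integral_const_mul] at hle
  linarith

lemma measurable_gaussianReal_preimage (a b : ℝ) (w : NNReal) {S : Set ℝ}
    (hS : MeasurableSet S) :
    Measurable fun x : ℝ ↦ gaussianReal a w ((fun y ↦ b * x + y) ⁻¹' S) :=
  measurable_measure_prodMk_left
    (hS.preimage (by fun_prop : Measurable fun p : ℝ × ℝ ↦ b * p.1 + p.2))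

/-- A Gaussian as the law of an affine image of a unit-variance Gaussian plus independent Gaussian
noise. -/
lemma gaussianReal_real_eq_integral {b : ℝ} {v w : NNReal} (h : (v : ℝ) = b ^ 2 + w) (a m : ℝ)
    {S : Set ℝ} (hS : MeasurableSet S) :
    (gaussianReal (b * m + a) v).real S =
      ∫ x, (gaussianReal a w).real ((fun y ↦ b * x + y) ⁻¹' S) ∂gaussianReal m 1 := by
  have hv : v = .mk (b ^ 2) (sq_nonneg _) * 1 + w := by
    ext
    simp [h]
  have hconv : gaussianReal (b * m + a) v S =
      ∫⁻ x, gaussianReal a w ((fun y ↦ b * x + y) ⁻¹' S) ∂gaussianReal m 1 := by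
    rw [hv, ← gaussianReal_conv_gaussianReal, ← gaussianReal_map_const_mul,
      ← lintegral_indicator_one hS, Measure.lintegral_conv (measurable_one.indicator hS),
      lintegral_map (Measurable.lintegral_prod_right' (f := fun p : ℝ × ℝ ↦
        S.indicator 1 (p.1 + p.2)) ((measurable_one.indicator hS).comp measurable_add))
        (by fun_prop)]
    refine lintegral_congr fun x ↦ ?_
    rw [← lintegral_indicator_one (hS.preimage (measurable_const_add _))]
    rfl
  rw [Measure.real, hconv]
  exact (integral_toReal (measurable_gaussianReal_preimage a b w hS).aemeasurable
    (.of_forall fun _ ↦ measure_lt_top _ _)).symm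

/-- The Gaussian mechanism with noise scale `σ` and sensitivity bound `Δ`
satisfies the `(ε, δ(ε, Δ/σ))`-DP inequality for all `ε ≥ 0`. -/
theorem gaussian_mechanism_sensitivity_dp
    (Δ σ : ℝ) (hΔ0 : 0 ≤ Δ) (hσ : 0 < σ) (hΔ : 0 < Δ)
    (fD fD' : ℝ) (hsens : |fD - fD'| ≤ Δ)
    (ε : ℝ) (hε : 0 ≤ ε) (S : Set ℝ) (hS : MeasurableSet S) :
    ((gaussianReal fD' (⟨σ ^ 2, sq_nonneg σ⟩ : NNReal)) S).toReal ≤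
      Real.exp ε * ((gaussianReal fD (⟨σ ^ 2, sq_nonneg σ⟩ : NNReal)) S).toReal +
        gdpDelta ε (Δ / σ) := by
  set c := (fD' - fD) / Δ with hc_def
  have hc : c ^ 2 ≤ 1 := by
    rw [sq_le_one_iff_abs_le_one, hc_def, abs_div, abs_of_pos hΔ, div_le_one hΔ, abs_sub_comm]
    exact hsens
  obtain ⟨w, hw⟩ : ∃ w : NNReal, (w : ℝ) = σ ^ 2 * (1 - c ^ 2) :=
    ⟨⟨_, mul_nonneg (sq_nonneg σ) (sub_nonneg.2 hc)⟩, rfl⟩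
  have hv : (((⟨σ ^ 2, sq_nonneg σ⟩ : NNReal)) : ℝ) = (σ * c) ^ 2 + w := by
    change σ ^ 2 = _
    rw [hw]
    ring
  have hP := gaussianReal_real_eq_integral hv fD (Δ / σ) hS
  have hQ := gaussianReal_real_eq_integral hv fD 0 hS
  have hmean : σ * c * (Δ / σ) + fD = fD' := by
    rw [hc_def]
    field_simp
    ring
  rw [hmean] at hP
  rw [mul_zero, zero_add] at hQ
  rw [← Measure.real, ← Measure.real, hP, hQ]
  exact integral_gaussianReal_le_add_gdpDelta (div_pos hΔ hσ) ε
    (measurable_gaussianReal_preimage fD (σ * c) w hS).ennreal_toReal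
    (fun _ ↦ measureReal_nonneg) (fun _ ↦ measureReal_le_one)
end
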